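/- arXiv:1509.09078 — 7 statements merged into one kernel-verified Lean document; each statement's English description precedes it below -/
import Mathlib

section
/- Let τ > 0, let H be a real Hilbert space, let g : [0,τ] → ℝ be continuously differentiable with g(0) ≠ 0, and let h : [0,τ] → H be continuous. Define v(t) = ∫_0^t g(t−s) h(s) ds and w(t) = g(0) h(t) + ∫_0^t g'(t−s) h(s) ds for t ∈ [0,τ]. Then (∫_0^τ ‖h(t)‖² dt)^{1/2} ≤ (√2 / |g(0)|) · exp( τ (∫_0^τ g'(s)² ds) / g(0)² ) · ( ∫_0^τ ‖v(t)‖² dt + ∫_0^τ ‖w(t)‖² dt )^{1/2}. -/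
open MeasureTheory intervalIntegral Set

/-- Cauchy–Schwarz for interval integrals of continuous real functions. -/
theorem sq_intervalIntegral_mul_le {f g : ℝ → ℝ} (hf : Continuous f) (hg : Continuous g)
    {a b : ℝ} (hab : a ≤ b) :
    (∫ s in a..b, f s * g s) ^ 2 ≤ (∫ s in a..b, f s ^ 2) * ∫ s in a..b, g s ^ 2 := by
  have key : ∀ x : ℝ, 0 ≤ (∫ s in a..b, f s ^ 2) * (x * x)
      + (2 * ∫ s in a..b, f s * g s) * x + ∫ s in a..b, g s ^ 2 := by
    intro x
    have h0 : 0 ≤ ∫ s in a..b, (f s * x + g s) ^ 2 :=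
      integral_nonneg hab fun s _ => sq_nonneg _
    have h1 : ∀ s, (f s * x + g s) ^ 2
        = (x * x) * f s ^ 2 + (2 * x) * (f s * g s) + g s ^ 2 := fun s => by ring
    simp_rw [h1] at h0
    rw [intervalIntegral.integral_add, intervalIntegral.integral_add,
      intervalIntegral.integral_const_mul, intervalIntegral.integral_const_mul] at h0
    · linarith
    all_goals exact Continuous.intervalIntegrable (by fun_prop) _ _
  have h := discrim_le_zero key
  simp only [discrim] at h
  linarith

/-- Integral form of Grönwall's inequality with a constant coefficient. -/
theorem intervalIntegral_le_exp_mul_of_le_add {u a : ℝ → ℝ} (hu : Continuous u)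
    (ha : Continuous a) (ha0 : ∀ t, 0 ≤ a t) {b τ : ℝ} (hb : 0 ≤ b) (hτ : 0 ≤ τ)
    (hle : ∀ t ∈ Icc 0 τ, u t ≤ a t + b * ∫ s in (0:ℝ)..t, u s) :
    ∫ t in (0:ℝ)..τ, u t ≤ Real.exp (b * τ) * ∫ t in (0:ℝ)..τ, a t := by
  have hd : ∀ t, HasDerivAt
      (fun t => Real.exp (-(b * t)) * (∫ s in (0:ℝ)..t, u s) - ∫ s in (0:ℝ)..t, a s)
      (Real.exp (-(b * t)) * (-(b * 1)) * (∫ s in (0:ℝ)..t, u s)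
        + Real.exp (-(b * t)) * u t - a t) t := fun t =>
    ((((hasDerivAt_id t).const_mul b).neg.exp).mul (hu.integral_hasStrictDerivAt 0 t).hasDerivAt).sub
      (ha.integral_hasStrictDerivAt 0 t).hasDerivAt
  have hanti := antitoneOn_of_deriv_nonpos (convex_Icc 0 τ)
    (fun t _ => (hd t).continuousAt.continuousWithinAt)
    (fun t _ => (hd t).differentiableAt.differentiableWithinAt)
    (fun t ht => by
      rw [interior_Icc] at ht
      rw [(hd t).deriv]
      have h1 : Real.exp (-(b * t)) ≤ 1 :=
        Real.exp_le_one_iff.2 (neg_nonpos.2 (mul_nonneg hb ht.1.le))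
      have h2 := mul_le_mul_of_nonneg_left (hle t (Ioo_subset_Icc_self ht))
        (Real.exp_nonneg (-(b * t)))
      have h3 := mul_le_mul_of_nonneg_right h1 (ha0 t)
      linarith)
  have h := hanti (left_mem_Icc.2 hτ) (right_mem_Icc.2 hτ) hτ
  simp only [integral_same, mul_zero, sub_zero, sub_nonpos] at h
  rw [Real.exp_neg] at h
  rwa [inv_mul_le_iff₀ (Real.exp_pos _)] at h

/-- Stability of a Volterra equation of the second kind with continuous kernel. -/
theorem volterra_second_kind_stability {H : Type*} [NormedAddCommGroup H] [NormedSpace ℝ H]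
    {c τ : ℝ} (hc : c ≠ 0) (hτ : 0 ≤ τ) {k : ℝ → ℝ} {h : ℝ → H} (hk : Continuous k)
    (hh : Continuous h) :
    ∫ t in (0:ℝ)..τ, ‖h t‖ ^ 2 ≤
      Real.exp (2 * (∫ s in (0:ℝ)..τ, k s ^ 2) / c ^ 2 * τ) *
        (2 / c ^ 2 *
          ∫ t in (0:ℝ)..τ, ‖c • h t + ∫ s in (0:ℝ)..t, k (t - s) • h s‖ ^ 2) := by
  have hc2 : 0 < c ^ 2 := by positivity
  have hK0 : 0 ≤ ∫ s in (0:ℝ)..τ, k s ^ 2 := integral_nonneg hτ fun s _ => sq_nonneg _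
  rw [← intervalIntegral.integral_const_mul (2 / c ^ 2)]
  refine intervalIntegral_le_exp_mul_of_le_add (u := fun t => ‖h t‖ ^ 2)
    (a := fun t => 2 / c ^ 2 * ‖c • h t + ∫ s in (0:ℝ)..t, k (t - s) • h s‖ ^ 2)
    (b := 2 * (∫ s in (0:ℝ)..τ, k s ^ 2) / c ^ 2) (by fun_prop) (by fun_prop)
    (fun t => by positivity) (by positivity) hτ fun t ht => ?_
  set y := ∫ s in (0:ℝ)..t, ‖h s‖ ^ 2
  set I := ∫ s in (0:ℝ)..t, k (t - s) • h s
  have hy : 0 ≤ y := integral_nonneg ht.1 fun s _ => sq_nonneg _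
  have hI : ‖I‖ ^ 2 ≤ (∫ s in (0:ℝ)..τ, k s ^ 2) * y := by
    have h1 : ‖I‖ ≤ ∫ s in (0:ℝ)..t, |k (t - s)| * ‖h s‖ := by
      refine (intervalIntegral.norm_integral_le_integral_norm ht.1).trans_eq ?_
      simp only [norm_smul, Real.norm_eq_abs]
    have h2 := sq_intervalIntegral_mul_le (f := fun s => |k (t - s)|) (g := fun s => ‖h s‖)
      (by fun_prop) (by fun_prop) ht.1
    have h3 : ∫ s in (0:ℝ)..t, |k (t - s)| ^ 2 = ∫ s in (0:ℝ)..t, k s ^ 2 := by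
      simp only [sq_abs]
      rw [integral_comp_sub_left (fun s => k s ^ 2)]
      simp
    have h4 : ∫ s in (0:ℝ)..t, k s ^ 2 ≤ ∫ s in (0:ℝ)..τ, k s ^ 2 :=
      integral_mono_interval le_rfl ht.1 ht.2 (.of_forall fun s => sq_nonneg _)
        (Continuous.intervalIntegrable (by fun_prop) _ _)
    rw [h3] at h2
    exact (pow_le_pow_left₀ (norm_nonneg _) h1 2).trans
      (h2.trans (mul_le_mul_of_nonneg_right h4 hy))
  have htri : |c| * ‖h t‖ ≤ ‖c • h t + I‖ + ‖I‖ := by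
    have := norm_sub_le (c • h t + I) I
    rwa [add_sub_cancel_right, norm_smul, Real.norm_eq_abs] at this
  have hsq : c ^ 2 * ‖h t‖ ^ 2 ≤ 2 * ‖c • h t + I‖ ^ 2 + 2 * ‖I‖ ^ 2 := by
    have := pow_le_pow_left₀ (by positivity) htri 2
    rw [mul_pow, sq_abs] at this
    nlinarith [sq_nonneg (‖c • h t + I‖ - ‖I‖)]
  rw [show 2 / c ^ 2 * ‖c • h t + I‖ ^ 2 + 2 * (∫ s in (0:ℝ)..τ, k s ^ 2) / c ^ 2 * y
    = (2 * ‖c • h t + I‖ ^ 2 + 2 * ((∫ s in (0:ℝ)..τ, k s ^ 2) * y)) / c ^ 2 by ring,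
    le_div_iff₀ hc2]
  linarith



/-- Quantitative stability for the Volterra operator `(Sh)(t) = ∫_0^t g(t-s) h(s) ds`:
`‖h‖_{L²} ≤ (√2/|g(0)|) e^{τ‖g'‖²_{L²}/g(0)²} ‖Sh‖_{H¹}`, where `w = (Sh)'`. -/
theorem volterra_stability {H : Type*} [NormedAddCommGroup H] [InnerProductSpace ℝ H]
    [CompleteSpace H] (τ : ℝ) (hτ : 0 < τ) (g g' : ℝ → ℝ) (h : ℝ → H)
    (hg : ∀ t ∈ Set.Icc 0 τ, HasDerivWithinAt g (g' t) (Set.Icc 0 τ) t)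
    (hg' : ContinuousOn g' (Set.Icc 0 τ))
    (hg0 : g 0 ≠ 0)
    (hh : ContinuousOn h (Set.Icc 0 τ))
    (v w : ℝ → H)
    (hv : ∀ t ∈ Set.Icc 0 τ, v t = ∫ s in (0:ℝ)..t, g (t - s) • h s)
    (hw : ∀ t ∈ Set.Icc 0 τ, w t = g 0 • h t + ∫ s in (0:ℝ)..t, g' (t - s) • h s) :
    Real.sqrt (∫ t in (0:ℝ)..τ, ‖h t‖ ^ 2) ≤
      Real.sqrt 2 / |g 0| *
        Real.exp (τ * (∫ s in (0:ℝ)..τ, g' s ^ 2) / g 0 ^ 2) *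
          Real.sqrt ((∫ t in (0:ℝ)..τ, ‖v t‖ ^ 2) + ∫ t in (0:ℝ)..τ, ‖w t‖ ^ 2) := by
  have hIcc : ∀ {t s : ℝ}, t ∈ Icc 0 τ → s ∈ Icc 0 t → s ∈ Icc 0 τ ∧ t - s ∈ Icc 0 τ :=
    fun ht hs => ⟨⟨hs.1, hs.2.trans ht.2⟩, sub_nonneg.2 hs.2, by linarith [hs.1, ht.2]⟩
  have hke := hg'.domRestrict.Icc_extend' (h := hτ.le)
  have hhe := hh.domRestrict.Icc_extend' (h := hτ.le)
  have main := volterra_second_kind_stability hg0 hτ.le hke hhe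
  have e1 : ∫ t in (0:ℝ)..τ, ‖IccExtend hτ.le ((Icc 0 τ).domRestrict h) t‖ ^ 2
      = ∫ t in (0:ℝ)..τ, ‖h t‖ ^ 2 := by
    refine integral_congr fun t ht => ?_
    rw [uIcc_of_le hτ.le] at ht
    simp only [IccExtend_of_mem hτ.le _ ht, domRestrict_apply]
  have e2 : ∫ t in (0:ℝ)..τ, IccExtend hτ.le ((Icc 0 τ).domRestrict g') t ^ 2
      = ∫ t in (0:ℝ)..τ, g' t ^ 2 := by
    refine integral_congr fun t ht => ?_
    rw [uIcc_of_le hτ.le] at ht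
    simp only [IccExtend_of_mem hτ.le _ ht, domRestrict_apply]
  have e3 : ∫ t in (0:ℝ)..τ, ‖g 0 • IccExtend hτ.le ((Icc 0 τ).domRestrict h) t
        + ∫ s in (0:ℝ)..t, IccExtend hτ.le ((Icc 0 τ).domRestrict g') (t - s) •
          IccExtend hτ.le ((Icc 0 τ).domRestrict h) s‖ ^ 2
      = ∫ t in (0:ℝ)..τ, ‖w t‖ ^ 2 := by
    refine integral_congr fun t ht => ?_
    rw [uIcc_of_le hτ.le] at ht
    have e : ∫ s in (0:ℝ)..t, IccExtend hτ.le ((Icc 0 τ).domRestrict g') (t - s) •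
          IccExtend hτ.le ((Icc 0 τ).domRestrict h) s = ∫ s in (0:ℝ)..t, g' (t - s) • h s := by
      refine integral_congr fun s hs => ?_
      rw [uIcc_of_le ht.1] at hs
      obtain ⟨h1, h2⟩ := hIcc ht hs
      simp only [IccExtend_of_mem hτ.le _ h1, IccExtend_of_mem hτ.le _ h2, domRestrict_apply]
    simp only [e, IccExtend_of_mem hτ.le _ ht, domRestrict_apply, hw t ht]
  rw [e1, e2, e3] at main
  have hv0 : 0 ≤ ∫ t in (0:ℝ)..τ, ‖v t‖ ^ 2 := integral_nonneg hτ.le fun t _ => sq_nonneg _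
  have hw0 : 0 ≤ ∫ t in (0:ℝ)..τ, ‖w t‖ ^ 2 := integral_nonneg hτ.le fun t _ => sq_nonneg _
  refine Real.sqrt_le_iff.2 ⟨by positivity, main.trans ?_⟩
  rw [mul_pow, mul_pow, div_pow, sq_abs, Real.sq_sqrt zero_le_two, Real.sq_sqrt (by positivity),
    ← Real.exp_nat_mul, ← mul_assoc, mul_comm (Real.exp _)]
  rw [show ((2 : ℕ) : ℝ) * (τ * (∫ s in (0:ℝ)..τ, g' s ^ 2) / g 0 ^ 2)
    = 2 * (∫ s in (0:ℝ)..τ, g' s ^ 2) / g 0 ^ 2 * τ by push_cast; ring]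
  exact mul_le_mul_of_nonneg_left (by linarith) (by positivity)
end

section
/- Let τ > 0, let H be a real Hilbert space, let g : [0,τ] → ℝ be continuously differentiable with g(0) ≠ 0, and let h : [0,τ] → H be continuous. If ∫_0^t g(t−s) h(s) ds = 0 for every t ∈ [0,τ], then h(t) = 0 for every t ∈ [0,τ]. -/
open MeasureTheory intervalIntegral Set

/-- **Grönwall's inequality** in homogeneous integral form. -/
theorem eq_zero_of_norm_le_mul_integral_norm {E : Type*} [NormedAddCommGroup E] {F : ℝ → E}
    {a b K : ℝ} (hF : Continuous F)
    (hbound : ∀ t ∈ Icc a b, ‖F t‖ ≤ K * ∫ s in a..t, ‖F s‖) :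
    ∀ t ∈ Icc a b, F t = 0 := by
  have hd (t : ℝ) : HasDerivAt (fun u => ∫ s in a..u, ‖F s‖) ‖F t‖ t :=
    (hF.norm.integral_hasStrictDerivAt a t).hasDerivAt
  have hnonneg (t : ℝ) (ht : t ∈ Icc a b) : 0 ≤ ∫ s in a..t, ‖F s‖ :=
    integral_nonneg ht.1 fun _ _ => norm_nonneg _
  have hw := eq_zero_of_abs_deriv_le_mul_abs_self_of_eq_zero_right (K := K)
    (fun t (_ : t ∈ Icc a b) => (hd t).continuousAt.continuousWithinAt)
    (fun t _ => (hd t).hasDerivWithinAt) integral_same fun t ht => by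
      have ht' := Ico_subset_Icc_self ht
      rw [norm_norm, Real.norm_of_nonneg (hnonneg t ht')]
      exact hbound t ht'
  intro t ht
  have := hbound t ht
  rwa [hw t ht, mul_zero, norm_le_zero_iff] at this

/-- Integration by parts for a convolution against a continuous function on `[0, t]`. -/
theorem integral_smul_convolution_eq {E : Type*} [NormedAddCommGroup E] [NormedSpace ℝ E]
    [CompleteSpace E] {g g' : ℝ → ℝ} {f : ℝ → E} {t : ℝ} (ht : 0 ≤ t)
    (hg : ∀ x ∈ Icc 0 t, HasDerivWithinAt g (g' x) (Icc 0 t) x)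
    (hg' : ContinuousOn g' (Icc 0 t)) (hf : Continuous f) :
    ∫ s in (0 : ℝ)..t, g (t - s) • f s =
      (g 0 • ∫ s in (0 : ℝ)..t, f s) +
        ∫ s in (0 : ℝ)..t, g' (t - s) • ∫ r in (0 : ℝ)..s, f r := by
  have hmaps : MapsTo (fun s => t - s) (Icc 0 t) (Icc 0 t) := fun s hs =>
    ⟨by linarith [hs.2], by linarith [hs.1]⟩
  have hu : ∀ s ∈ uIcc 0 t, HasDerivWithinAt (fun s => g (t - s)) (-g' (t - s)) (uIcc 0 t) s := by
    rw [uIcc_of_le ht]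
    intro s hs
    have := (hg (t - s) (hmaps hs)).scomp s
      ((hasDerivAt_id s).const_sub t).hasDerivWithinAt hmaps
    simpa [Function.comp_def] using this
  have hu' : IntervalIntegrable (fun s => -g' (t - s)) volume 0 t := by
    refine ContinuousOn.intervalIntegrable ?_
    rw [uIcc_of_le ht]
    exact (hg'.comp (by fun_prop) hmaps).neg
  rw [integral_smul_deriv_eq_deriv_smul_of_hasDerivWithinAt
    (v := fun s => ∫ r in (0 : ℝ)..s, f r) hu
    (fun s _ => (hf.integral_hasStrictDerivAt 0 s).hasDerivAt.hasDerivWithinAt) hu'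
    (hf.intervalIntegrable _ _)]
  simp

/-- Injectivity of the Volterra convolution operator `(Sh)(t) = ∫_0^t g(t-s) h(s) ds`
when `g(0) ≠ 0`. -/
theorem volterra_injective {H : Type*} [NormedAddCommGroup H] [InnerProductSpace ℝ H]
    [CompleteSpace H] (τ : ℝ) (hτ : 0 < τ) (g g' : ℝ → ℝ) (h : ℝ → H)
    (hg : ∀ t ∈ Set.Icc 0 τ, HasDerivWithinAt g (g' t) (Set.Icc 0 τ) t)
    (hg' : ContinuousOn g' (Set.Icc 0 τ))
    (hg0 : g 0 ≠ 0)
    (hh : ContinuousOn h (Set.Icc 0 τ))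
    (hzero : ∀ t ∈ Set.Icc 0 τ, (∫ s in (0:ℝ)..t, g (t - s) • h s) = 0) :
    ∀ t ∈ Set.Icc 0 τ, h t = 0 := by
  obtain ⟨C, hC⟩ := isCompact_Icc.exists_bound_of_continuousOn hg'
  set f : ℝ → H := IccExtend hτ.le ((Icc 0 τ).domRestrict h)
  have hf : Continuous f := hh.domRestrict.Icc_extend'
  have hfh (t : ℝ) (ht : t ∈ Icc 0 τ) : f t = h t := IccExtend_of_mem hτ.le _ ht
  set F : ℝ → H := fun t => ∫ s in (0 : ℝ)..t, f s
  have hFd (t : ℝ) : HasDerivAt F (f t) t := (hf.integral_hasStrictDerivAt 0 t).hasDerivAt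
  have hF : Continuous F := continuous_iff_continuousAt.2 fun t => (hFd t).continuousAt
  have hF0 : ∀ t ∈ Icc 0 τ, F t = 0 := by
    refine eq_zero_of_norm_le_mul_integral_norm (K := C / ‖g 0‖) hF fun t ht => ?_
    have hsub : Icc 0 t ⊆ Icc 0 τ := Icc_subset_Icc_right ht.2
    have hparts : (g 0 • F t) + ∫ s in (0 : ℝ)..t, g' (t - s) • F s = 0 := by
      rw [← integral_smul_convolution_eq ht.1 (fun x hx => (hg x (hsub hx)).mono hsub)
        (hg'.mono hsub) hf, ← hzero t ht]
      refine integral_congr fun s hs => ?_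
      rw [uIcc_of_le ht.1] at hs
      simp only [hfh s (hsub hs)]
    have hnorm : ‖g 0‖ * ‖F t‖ ≤ C * ∫ s in (0 : ℝ)..t, ‖F s‖ := by
      rw [← norm_smul, eq_neg_of_add_eq_zero_left hparts, norm_neg, ← intervalIntegral.integral_const_mul]
      refine norm_integral_le_of_norm_le ht.1 (ae_of_all _ fun s hs => ?_)
        ((hF.norm.const_mul C).intervalIntegrable _ _)
      rw [norm_smul]
      gcongr
      exact hC _ ⟨by linarith [hs.2], by linarith [hs.1, ht.2]⟩
    rwa [div_mul_eq_mul_div, le_div_iff₀' (norm_pos_iff.2 hg0)]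
  intro t ht
  rw [← hfh t ht]
  exact (uniqueDiffOn_Icc hτ t ht).eq_deriv _ (hFd t).hasDerivWithinAt
    ((hasDerivWithinAt_const t _ (0 : H)).congr hF0 (hF0 t ht))
end

section
/- Let H be a real Hilbert space with orthonormal (Hilbert) basis (φ_k)_{k ≥ 1}, let (λ_k)_{k ≥ 1} be a nondecreasing sequence of positive real numbers, let τ > 0, and let f ∈ H and M ≥ 0 satisfy Σ_{k ≥ 1} λ_k ⟨f, φ_k⟩² ≤ M². Define u = Σ_{k ≥ 1} e^{−λ_k τ} ⟨f, φ_k⟩ φ_k (the series converges in H). Then for every integer N ≥ 1, ‖f‖² ≤ N e^{2 λ_N τ} ‖u‖² + M² / λ_{N+1}. -/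
open RealInnerProductSpace

theorem HilbertBasis.hasSum_inner_sq {ι H : Type*} [NormedAddCommGroup H]
    [InnerProductSpace ℝ H] (φ : HilbertBasis ι ℝ H) (f : H) :
    HasSum (fun k => ⟪f, φ k⟫ ^ 2) (‖f‖ ^ 2) := by
  have h := φ.hasSum_inner_mul_inner f f
  rw [real_inner_self_eq_norm_sq] at h
  refine h.congr_fun fun k => ?_
  rw [real_inner_comm f (φ k), sq]

theorem HilbertBasis.inner_tsum_smul {ι H : Type*} [NormedAddCommGroup H]
    [InnerProductSpace ℝ H] (φ : HilbertBasis ι ℝ H) {c : ι → ℝ}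
    (hc : Summable fun k => c k ^ 2) (k : ι) :
    ⟪φ k, ∑' i, c i • φ i⟫ = c k := by
  have hmem : Memℓp c 2 := memℓp_gen (by simpa using hc)
  rw [(φ.hasSum_repr_symm ⟨c, hmem⟩).tsum_eq, ← φ.repr_apply_apply,
    LinearIsometryEquiv.apply_symm_apply]

/-- Abstract form of estimate (3.8): with `u = Σ e^{-λ_k τ} ⟨f,φ_k⟩ φ_k` (final-time heat
state), one has `‖f‖² ≤ N e^{2 λ_N τ} ‖u‖² + M²/λ_{N+1}`. -/
theorem heat_spectral_estimate {H : Type*} [NormedAddCommGroup H] [InnerProductSpace ℝ H]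
    [CompleteSpace H] (φ : HilbertBasis ℕ+ ℝ H) (lam : ℕ+ → ℝ)
    (hpos : ∀ k, 0 < lam k) (hmono : Monotone lam) (τ : ℝ) (hτ : 0 < τ)
    (f : H) (M : ℝ) (hM : 0 ≤ M)
    (hsum : Summable fun k => lam k * ⟪f, φ k⟫ ^ 2)
    (hbound : ∑' k, lam k * ⟪f, φ k⟫ ^ 2 ≤ M ^ 2)
    (u : H) (hu : u = ∑' k, (Real.exp (-lam k * τ) * ⟪f, φ k⟫) • φ k) :
    ∀ N : ℕ+, ‖f‖ ^ 2 ≤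
      (N : ℝ) * Real.exp (2 * lam N * τ) * ‖u‖ ^ 2 + M ^ 2 / lam (N + 1) := by
  intro N
  have hf := φ.hasSum_inner_sq f
  have hc : Summable fun k => (Real.exp (-lam k * τ) * ⟪f, φ k⟫) ^ 2 := by
    refine Summable.of_nonneg_of_le (fun k => sq_nonneg _) (fun k => ?_) hf.summable
    rw [mul_pow]
    refine mul_le_of_le_one_left (sq_nonneg _) (pow_le_one₀ (Real.exp_pos _).le ?_)
    rw [Real.exp_le_one_iff]
    nlinarith [mul_pos (hpos k) hτ]
  have hmode (k : ℕ+) : ⟪f, φ k⟫ ^ 2 ≤ Real.exp (2 * lam k * τ) * ‖u‖ ^ 2 := by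
    have h : |⟪φ k, u⟫| ≤ ‖u‖ := by
      simpa [φ.orthonormal.1 k] using abs_real_inner_le_norm (φ k) u
    have hsq : ⟪φ k, u⟫ ^ 2 ≤ ‖u‖ ^ 2 := sq_le_sq' (abs_le.1 h).1 (abs_le.1 h).2
    have hin : ⟪φ k, u⟫ = Real.exp (-lam k * τ) * ⟪f, φ k⟫ := by
      rw [hu, φ.inner_tsum_smul hc]
    calc ⟪f, φ k⟫ ^ 2 = Real.exp (2 * lam k * τ) * ⟪φ k, u⟫ ^ 2 := by
          rw [hin, mul_pow, ← Real.exp_nat_mul, ← mul_assoc, ← Real.exp_add]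
          ring_nf
          simp
      _ ≤ _ := by gcongr
  set C := Real.exp (2 * lam N * τ) * ‖u‖ ^ 2 with hC
  have hlow : HasSum (fun k => if k ∈ Finset.Icc 1 N then C else 0) ((N : ℝ) * C) := by
    have h := hasSum_sum_of_ne_finset_zero (L := .unconditional _) (s := Finset.Icc 1 N)
      (f := fun k => if k ∈ Finset.Icc 1 N then C else 0) fun k hk => if_neg hk
    rwa [Finset.sum_ite_mem, Finset.inter_self, Finset.sum_const, PNat.card_Icc,
      nsmul_eq_mul, PNat.one_coe, Nat.add_sub_cancel] at h
  have hle := hasSum_le (fun k => ?_) hf (hlow.add (hsum.hasSum.div_const (lam (N + 1))))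
  · calc ‖f‖ ^ 2 ≤ _ := hle
      _ ≤ _ := by
        rw [mul_assoc, ← hC]
        gcongr
        exact (hpos _).le
  · have hp := hpos (N + 1)
    by_cases hk : k ≤ N
    · rw [if_pos (Finset.mem_Icc.2 ⟨one_le, hk⟩)]
      have h1 : ⟪f, φ k⟫ ^ 2 ≤ C := (hmode k).trans (by
        have := hmono hk
        rw [hC]
        gcongr)
      have h2 : 0 ≤ lam k * ⟪f, φ k⟫ ^ 2 / lam (N + 1) := by
        have := hpos k
        positivity
      linarith
    · rw [if_neg (fun h => hk (Finset.mem_Icc.1 h).2), zero_add, le_div_iff₀ hp, mul_comm]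
      gcongr
      exact hmono (PNat.add_one_le_iff.2 (not_le.1 hk))
end

section
/- Let μ > 0, K > 0 and M > 0. There exists a constant C > 0, depending only on μ, K and M, such that for all real numbers A and γ with 0 ≤ A ≤ M and γ > 0, if A ≤ ε^{−1/2} + K e^{μ ε} γ for every ε > 0, then A ≤ C (|ln γ|^{−1/2} + γ). -/
/-- The exponential `e^{-x/2}` is dominated by `x^{-1/2}` on the positive half-line. -/
theorem Real.exp_neg_half_le_rpow {x : ℝ} (hx : 0 < x) :
    Real.exp (-(x / 2)) ≤ x ^ (-(1 / 2 : ℝ)) := by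
  rw [Real.rpow_def_of_pos hx, Real.exp_le_exp]
  linarith [Real.log_le_sub_one_of_pos hx]

/-- Minimization-in-ε argument of Remark 1.1: if `A ≤ ε^{-1/2} + K e^{με} γ` for all
`ε > 0` and `A ≤ M` a priori, then `A ≤ C (|ln γ|^{-1/2} + γ)`. -/
theorem remark_minimization (μ K M : ℝ) (hμ : 0 < μ) (hK : 0 < K) (hM : 0 < M) :
    ∃ C > 0, ∀ A γ : ℝ, 0 ≤ A → A ≤ M → 0 < γ →
      (∀ ε : ℝ, 0 < ε → A ≤ ε ^ (-(1 / 2 : ℝ)) + K * Real.exp (μ * ε) * γ) →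
      A ≤ C * (|Real.log γ| ^ (-(1 / 2 : ℝ)) + γ) := by
  have hc : 0 < ((2 * μ)⁻¹) ^ (-(1 / 2 : ℝ)) := by positivity
  set c := ((2 * μ)⁻¹) ^ (-(1 / 2 : ℝ)) with hcdef
  refine ⟨M + c + K, by positivity, fun A γ _ hAM hγ h => ?_⟩
  have hP : 0 ≤ |Real.log γ| ^ (-(1 / 2 : ℝ)) := by positivity
  rcases le_or_gt 1 γ with h1 | h1
  · calc A ≤ M * 1 := by linarith
      _ ≤ (M + c + K) * (|Real.log γ| ^ (-(1 / 2 : ℝ)) + γ) := by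
        gcongr <;> linarith
  · have hlog : Real.log γ < 0 := Real.log_neg hγ h1
    have hL : 0 < |Real.log γ| := abs_pos.2 hlog.ne
    have hlogL : Real.log γ = -|Real.log γ| := by rw [abs_of_neg hlog, neg_neg]
    set L := |Real.log γ|
    have hexp : Real.exp (μ * (L * (2 * μ)⁻¹)) * γ = Real.exp (-(L / 2)) := by
      rw [← Real.exp_log hγ, hlogL, ← Real.exp_add]
      congr 1
      field_simp
      ring
    have key := h (L * (2 * μ)⁻¹) (by positivity)
    rw [mul_assoc K, hexp, Real.mul_rpow hL.le (by positivity), ← hcdef] at key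
    have hdecay := mul_le_mul_of_nonneg_left (Real.exp_neg_half_le_rpow hL) hK.le
    have hMP : 0 ≤ M * L ^ (-(1 / 2 : ℝ)) := by positivity
    have hCγ : 0 ≤ (M + c + K) * γ := by positivity
    linarith
end

section
/- Let n ≥ 2 be an integer and let θ > 0 and M > 0. There exists a constant C > 0, depending only on n, θ and M, such that for all real numbers A and γ with 0 ≤ A ≤ M and γ > 0, if A² ≤ s^{1+2/n}/ε + s^{−2/n} + e^{θ s^{1+4/n}} e^{θ ε} γ² for all s ≥ 1 and all ε ≥ 1, then A ≤ C (|ln γ|^{−1/(1+4n)} + γ). -/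
/-- The choices `ε = s ^ (1 + 4 / n) = T` reduce the two-parameter bound to a one-parameter one. -/
lemma le_of_two_parameter_bound {n : ℕ} (hn : 0 < n) {θ A γ : ℝ}
    (h : ∀ s : ℝ, 1 ≤ s → ∀ ε : ℝ, 1 ≤ ε →
        A ^ 2 ≤ s ^ (1 + 2 / (n : ℝ)) / ε + s ^ (-(2 / (n : ℝ))) +
          Real.exp (θ * s ^ (1 + 4 / (n : ℝ))) * Real.exp (θ * ε) * γ ^ 2)
    {T : ℝ} (hT : 1 ≤ T) :
    A ^ 2 ≤ 2 * T ^ (-(2 / ((n : ℝ) + 4))) + Real.exp (2 * θ * T) * γ ^ 2 := by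
  have hn' : (0 : ℝ) < n := by exact_mod_cast hn
  have hT0 : 0 < T := by linarith
  have hs : 1 ≤ T ^ ((n : ℝ) / (n + 4)) := Real.one_le_rpow hT (by positivity)
  have key := h _ hs T hT
  have e₁ : (T ^ ((n : ℝ) / (n + 4))) ^ (1 + 4 / (n : ℝ)) = T := by
    rw [← Real.rpow_mul hT0.le]
    convert Real.rpow_one T using 2
    field_simp
  have e₂ : (T ^ ((n : ℝ) / (n + 4))) ^ (-(2 / (n : ℝ))) = T ^ (-(2 / ((n : ℝ) + 4))) := by
    rw [← Real.rpow_mul hT0.le]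
    congr 1
    field_simp
  have e₃ : (T ^ ((n : ℝ) / (n + 4))) ^ (1 + 2 / (n : ℝ)) / T = T ^ (-(2 / ((n : ℝ) + 4))) := by
    rw [← Real.rpow_mul hT0.le, ← Real.rpow_sub_one hT0.ne']
    congr 1
    field_simp
    ring
  rw [e₁, e₂, e₃, ← Real.exp_add, ← two_mul, ← two_mul, ← mul_assoc] at key
  exact key


/-- Two-parameter optimization for the heat equation: if
`A² ≤ s^{1+2/n}/ε + s^{-2/n} + e^{θ s^{1+4/n}} e^{θε} γ²` for all `s, ε ≥ 1`,
then `A ≤ C (|ln γ|^{-1/(1+4n)} + γ)`. -/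
theorem heat_optimization (n : ℕ) (hn : 2 ≤ n) (θ M : ℝ) (hθ : 0 < θ) (hM : 0 < M) :
    ∃ C > 0, ∀ A γ : ℝ, 0 ≤ A → A ≤ M → 0 < γ →
      (∀ s : ℝ, 1 ≤ s → ∀ ε : ℝ, 1 ≤ ε →
        A ^ 2 ≤ s ^ (1 + 2 / (n : ℝ)) / ε + s ^ (-(2 / (n : ℝ))) +
          Real.exp (θ * s ^ (1 + 4 / (n : ℝ))) * Real.exp (θ * ε) * γ ^ 2) →
      A ≤ C * (|Real.log γ| ^ (-(1 / (1 + 4 * (n : ℝ)))) + γ) := by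
  have hn' : (2 : ℝ) ≤ n := by exact_mod_cast hn
  set a : ℝ := 1 / (1 + 4 * (n : ℝ)) with ha
  have ha0 : 0 < a := by positivity
  have ha1 : 2 * a ≤ 1 := by
    rw [ha, ← mul_div_assoc, div_le_one (by positivity)]
    linarith
  have ha2 : 2 * a ≤ 2 / ((n : ℝ) + 4) := by
    rw [ha, ← mul_div_assoc, mul_one]
    gcongr 2 / ?_
    linarith
  set L₀ : ℝ := max (2 * θ) 1
  set K : ℝ := 2 * (2 * θ) ^ (2 * a) + 1
  have hK : 1 ≤ K := le_add_of_nonneg_left (by positivity)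
  refine ⟨K + M * Real.exp L₀, by positivity, fun A γ _ hAM hγ h => ?_⟩
  have hpow : 0 ≤ |Real.log γ| ^ (-a) := by positivity
  rcases le_or_gt (-Real.log γ) L₀ with hL | hL
  · have hγL : 1 ≤ Real.exp L₀ * γ := by
      suffices 1 ≤ Real.exp (L₀ + Real.log γ) by rwa [Real.exp_add, Real.exp_log hγ] at this
      exact Real.one_le_exp (by linarith)
    calc A ≤ M * 1 := by linarith
      _ ≤ M * (Real.exp L₀ * γ) := by gcongr
      _ = M * Real.exp L₀ * γ := by ring
      _ ≤ (K + M * Real.exp L₀) * (|Real.log γ| ^ (-a) + γ) := by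
        gcongr <;> linarith
  · obtain ⟨L, hLdef⟩ : ∃ L, L = -Real.log γ := ⟨_, rfl⟩
    rw [← hLdef] at hL
    have hL1 : 1 < L := (le_max_right _ _).trans_lt hL
    have hLθ : 2 * θ < L := (le_max_left _ _).trans_lt hL
    have hL0 : 0 < L := by linarith
    have habs : |Real.log γ| = L := by
      rw [abs_of_neg (by linarith), hLdef]
    have hT : 1 ≤ L / (2 * θ) := by
      rw [le_div_iff₀ (by positivity)]
      linarith
    have key := le_of_two_parameter_bound (by omega) h hT
    have hexp : Real.exp (2 * θ * (L / (2 * θ))) * γ ^ 2 ≤ L ^ (-(2 * a)) := by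
      have hγL : γ = Real.exp (-L) := by rw [hLdef, neg_neg, Real.exp_log hγ]
      calc Real.exp (2 * θ * (L / (2 * θ))) * γ ^ 2 = (Real.exp L)⁻¹ := by
            rw [mul_div_cancel₀ _ (by positivity), ← Real.exp_neg, hγL, ← Real.exp_nat_mul,
              ← Real.exp_add]
            congr 1
            push_cast
            ring
        _ ≤ L⁻¹ := by
            gcongr
            linarith [Real.add_one_le_exp L]
        _ = L ^ (-1 : ℝ) := (Real.rpow_neg_one L).symm
        _ ≤ L ^ (-(2 * a)) := Real.rpow_le_rpow_of_exponent_le hL1.le (by linarith)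
    have hmain : (L / (2 * θ)) ^ (-(2 / ((n : ℝ) + 4))) ≤ (2 * θ) ^ (2 * a) * L ^ (-(2 * a)) := by
      calc _ ≤ (L / (2 * θ)) ^ (-(2 * a)) :=
            Real.rpow_le_rpow_of_exponent_le hT (by linarith)
        _ = _ := by
            rw [Real.div_rpow hL0.le (by positivity), Real.rpow_neg (by positivity : 0 ≤ 2 * θ),
              div_inv_eq_mul, mul_comm]
    have hsq : L ^ (-(2 * a)) = (L ^ (-a)) ^ 2 := by
      rw [← Real.rpow_natCast, ← Real.rpow_mul hL0.le]
      congr 1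
      push_cast
      ring
    rw [habs] at hpow ⊢
    have hA : A ≤ K * L ^ (-a) := by
      refine le_of_abs_le (abs_le_of_sq_le_sq ?_ (by positivity))
      calc A ^ 2 ≤ K * (L ^ (-a)) ^ 2 := by
            rw [← hsq]
            linarith
        _ ≤ K ^ 2 * (L ^ (-a)) ^ 2 := by
            gcongr
            nlinarith
        _ = (K * L ^ (-a)) ^ 2 := by ring
    refine hA.trans ?_
    gcongr
    · exact le_add_of_nonneg_right (by positivity)
    · exact le_add_of_nonneg_right hγ.le
end

section
/- Let n ≥ 2 be an integer and let ρ > 0, μ > 0, M > 0. There exists a constant C > 0, depending only on n, ρ, μ and M, with the following property. Let H be a real Hilbert space with orthonormal (Hilbert) basis (φ_k)_{k ≥ 1}, let f ∈ H with ‖f‖ ≤ M and Σ_{k ≥ 1} k^{2/n} ⟨f, φ_k⟩² ≤ M², and let γ > 0. If for every integer k ≥ 1 and every ε > 0 one has ⟨f, φ_k⟩² ≤ k^{2/n}/√ε + e^{ρ k^{2/n}} e^{μ ε} γ, then ‖f‖ ≤ C (|ln γ|^{−1/(8+2n)} + γ). -/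
open RealInnerProductSpace

/-- Splitting the Parseval sum at the frequency `R`: if the coefficients `⟪f, φ k⟫ ^ 2` with `k ≤ R`
are bounded by `B`, the remaining ones are controlled by the weighted sum. -/
theorem HilbertBasis.norm_sq_le_of_low_modes {H : Type*} [NormedAddCommGroup H]
    [InnerProductSpace ℝ H] (φ : HilbertBasis ℕ+ ℝ H) (f : H) {a M R B : ℝ}
    (ha : 0 ≤ a) (hR : 0 < R) (hB : 0 ≤ B)
    (hs : Summable fun k : ℕ+ => (k : ℝ) ^ a * ⟪f, φ k⟫ ^ 2)
    (hM : ∑' k : ℕ+, (k : ℝ) ^ a * ⟪f, φ k⟫ ^ 2 ≤ M)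
    (hlow : ∀ k : ℕ+, (k : ℝ) ≤ R → ⟪f, φ k⟫ ^ 2 ≤ B) :
    ‖f‖ ^ 2 ≤ R * B + M / R ^ a := by
  have hparseval : HasSum (fun k : ℕ+ => ⟪f, φ k⟫ ^ 2) (‖f‖ ^ 2) := by
    rw [← real_inner_self_eq_norm_sq]
    refine (φ.hasSum_inner_mul_inner f f).congr_fun ?_
    intro k
    rw [real_inner_comm f (φ k), sq]
  have hRa : 0 < R ^ a := Real.rpow_pos_of_pos hR a
  refine hasSum_le_of_sum_le hparseval fun S => ?_
  rw [← Finset.sum_filter_add_sum_filter_not S fun k : ℕ+ => (k : ℝ) ≤ R]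
  refine add_le_add ?_ ?_
  · have hcard : ((S.filter fun k : ℕ+ => (k : ℝ) ≤ R).card : ℝ) ≤ R := by
      refine le_trans ?_ (Nat.floor_le hR.le)
      have h : (S.filter fun k : ℕ+ => (k : ℝ) ≤ R).card ≤ (Finset.Icc 1 ⌊R⌋₊).card := by
        refine Finset.card_le_card_of_injOn (fun k : ℕ+ => (k : ℕ)) ?_ PNat.coe_injective.injOn
        intro k hk
        have hk' := (Finset.mem_filter.mp hk).2
        exact Finset.mem_coe.mpr (Finset.mem_Icc.mpr ⟨k.pos, Nat.le_floor hk'⟩)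
      rw [Nat.card_Icc, Nat.add_sub_cancel] at h
      exact_mod_cast h
    refine (Finset.sum_le_card_nsmul _ _ B fun k hk => hlow k (Finset.mem_filter.mp hk).2).trans ?_
    rw [nsmul_eq_mul]
    exact mul_le_mul_of_nonneg_right hcard hB
  · rw [le_div_iff₀ hRa, Finset.sum_mul]
    refine le_trans (Finset.sum_le_sum fun k hk => ?_)
      ((hs.sum_le_tsum (S.filter fun k : ℕ+ => ¬(k : ℝ) ≤ R) fun k _ => by positivity).trans hM)
    rw [mul_comm]
    have hk' := (not_le.mp (Finset.mem_filter.mp hk).2).le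
    exact mul_le_mul_of_nonneg_right (Real.rpow_le_rpow hR.le hk' ha) (sq_nonneg _)

/-- The exponentially weighted error is harmless at the cutoff `u ^ n` when
`γ = exp (-u ^ (2 * n + 8))`. -/
theorem pow_mul_exp_mul_exp_le (n : ℕ) (ρ : ℝ) {u : ℝ} (hu : 1 ≤ u) :
    u ^ n * (Real.exp (ρ * u ^ 2) * Real.exp (u ^ (2 * n + 8) / 4) *
      Real.exp (-u ^ (2 * n + 8))) ≤ 2 * Real.exp (ρ ^ 2) / u ^ 2 := by
  set L := u ^ (2 * n + 8) with hL
  have hu0 : 0 < u := by linarith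
  rw [le_div_iff₀ (by positivity), ← Real.exp_add, ← Real.exp_add]
  have h1 : u ^ n * u ^ 2 ≤ L := by
    rw [← pow_add]
    exact pow_le_pow_right₀ hu (by omega)
  have h2 : (u ^ 2) ^ 2 ≤ L := by
    rw [← pow_mul]
    exact pow_le_pow_right₀ hu (by omega)
  have h3 : ρ * u ^ 2 + L / 4 + -L ≤ ρ ^ 2 + -(L / 2) := by
    nlinarith [sq_nonneg (u ^ 2 / 2 - ρ)]
  have h4 : L ≤ 2 * Real.exp (L / 2) := by
    linarith [Real.add_one_le_exp (L / 2)]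
  calc u ^ n * Real.exp (ρ * u ^ 2 + L / 4 + -L) * u ^ 2
      = u ^ n * u ^ 2 * Real.exp (ρ * u ^ 2 + L / 4 + -L) := by ring
    _ ≤ 2 * Real.exp (L / 2) * Real.exp (ρ ^ 2 + -(L / 2)) :=
      mul_le_mul (h1.trans h4) (Real.exp_le_exp.mpr h3) (Real.exp_nonneg _) (by positivity)
    _ = 2 * Real.exp (ρ ^ 2) := by
      rw [mul_assoc, ← Real.exp_add]
      congr 2
      ring

/-- Abstract spectral skeleton of Theorem 1.1 (wave equation): per-mode bounds
`⟨f,φ_k⟩² ≤ k^{2/n}/√ε + e^{ρ k^{2/n}} e^{με} γ`, together with the a priori bounds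
`‖f‖ ≤ M` and `Σ k^{2/n} ⟨f,φ_k⟩² ≤ M²`, imply `‖f‖ ≤ C (|ln γ|^{-1/(8+2n)} + γ)`. -/
theorem wave_stability_skeleton (n : ℕ) (hn : 2 ≤ n) (ρ μ M : ℝ)
    (hρ : 0 < ρ) (hμ : 0 < μ) (hM : 0 < M) :
    ∃ C > 0, ∀ (H : Type) (_ : NormedAddCommGroup H), ∀ (_ : InnerProductSpace ℝ H)
      (_ : CompleteSpace H) (φ : HilbertBasis ℕ+ ℝ H) (f : H) (γ : ℝ),
      ‖f‖ ≤ M →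
      Summable (fun k : ℕ+ => (k : ℝ) ^ ((2 : ℝ) / n) * ⟪f, φ k⟫ ^ 2) →
      (∑' k : ℕ+, (k : ℝ) ^ ((2 : ℝ) / n) * ⟪f, φ k⟫ ^ 2) ≤ M ^ 2 →
      0 < γ →
      (∀ k : ℕ+, ∀ ε : ℝ, 0 < ε →
        ⟪f, φ k⟫ ^ 2 ≤ (k : ℝ) ^ ((2 : ℝ) / n) / Real.sqrt ε +
          Real.exp (ρ * (k : ℝ) ^ ((2 : ℝ) / n)) * Real.exp (μ * ε) * γ) →
      ‖f‖ ≤ C * (|Real.log γ| ^ (-(1 / (8 + 2 * (n : ℝ)))) + γ) := by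
  set K : ℝ := 2 * Real.sqrt μ + 2 * Real.exp (ρ ^ 2) + M ^ 2 with hK
  have hK0 : 0 ≤ K := by positivity
  refine ⟨Real.sqrt K + M * Real.exp 1, by positivity, ?_⟩
  intro H _ _ _ φ f γ hf hs hsM hγ hmode
  rcases lt_or_ge (Real.exp (-1)) γ with hγ1 | hγ1
  · have h1 : 1 ≤ Real.exp 1 * γ := by
      calc (1 : ℝ) = Real.exp 1 * Real.exp (-1) := by rw [← Real.exp_add]; simp
        _ ≤ Real.exp 1 * γ := by gcongr
    calc ‖f‖ ≤ M * 1 := by linarith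
      _ ≤ M * (Real.exp 1 * γ) := by gcongr
      _ = (M * Real.exp 1) * γ := by ring
      _ ≤ _ := mul_le_mul (by linarith [Real.sqrt_nonneg K])
        (le_add_of_nonneg_left (by positivity)) hγ.le (by positivity)
  · have hlog : Real.log γ ≤ -1 := (Real.log_le_iff_le_exp hγ).mpr hγ1
    have hn0 : (0 : ℝ) < n := by exact_mod_cast (by omega : 0 < n)
    set u : ℝ := |Real.log γ| ^ (1 / (8 + 2 * (n : ℝ))) with hu
    have habs : |Real.log γ| = -Real.log γ := abs_of_neg (by linarith)
    have hu1 : 1 ≤ u := Real.one_le_rpow (by rw [habs]; linarith) (by positivity)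
    have hu0 : 0 < u := by linarith
    have huL : u ^ (2 * n + 8) = -Real.log γ := by
      rw [← habs, hu, ← Real.rpow_natCast, ← Real.rpow_mul (abs_nonneg _)]
      have h : 1 / (8 + 2 * (n : ℝ)) * ((2 * n + 8 : ℕ) : ℝ) = 1 := by
        push_cast
        field_simp
        ring
      rw [h, Real.rpow_one]
    have hγu : γ = Real.exp (-u ^ (2 * n + 8)) := by
      rw [huL, neg_neg, Real.exp_log hγ]
    have hcut : (u ^ n) ^ ((2 : ℝ) / n) = u ^ 2 := by
      rw [← Real.rpow_natCast, ← Real.rpow_mul hu0.le, mul_div_cancel₀ _ hn0.ne']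
      exact_mod_cast Real.rpow_natCast u 2
    set ε : ℝ := u ^ (2 * n + 8) / (4 * μ) with hε
    have hε0 : 0 < ε := by positivity
    have hμε : μ * ε = u ^ (2 * n + 8) / 4 := by
      rw [hε]
      field_simp
    have hsqrt : Real.sqrt ε = u ^ (n + 4) / (2 * Real.sqrt μ) := by
      rw [Real.sqrt_eq_iff_mul_self_eq_of_pos (by positivity), hε]
      rw [div_mul_div_comm, ← pow_add, mul_mul_mul_comm, Real.mul_self_sqrt hμ.le]
      congr 1
      · congr 1; ring
      · ring
    have hlow : ∀ k : ℕ+, (k : ℝ) ≤ u ^ n → ⟪f, φ k⟫ ^ 2 ≤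
        u ^ 2 / Real.sqrt ε + Real.exp (ρ * u ^ 2) * Real.exp (μ * ε) * γ := by
      intro k hk
      have hk2 : (k : ℝ) ^ ((2 : ℝ) / n) ≤ u ^ 2 := by
        rw [← hcut]
        exact Real.rpow_le_rpow (by positivity) hk (by positivity)
      refine (hmode k ε hε0).trans ?_
      gcongr
    have hnorm := φ.norm_sq_le_of_low_modes f (by positivity) (by positivity) (by positivity)
      hs hsM hlow
    have hmain : u ^ n * (u ^ 2 / Real.sqrt ε) = 2 * Real.sqrt μ / u ^ 2 := by
      rw [hsqrt]
      field_simp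
      ring
    have hexp := pow_mul_exp_mul_exp_le n ρ hu1
    rw [← hγu, ← hμε] at hexp
    have hsq : ‖f‖ ^ 2 ≤ K / u ^ 2 := by
      rw [hcut, mul_add, hmain] at hnorm
      rw [hK, add_div, add_div]
      linarith
    have hfu : ‖f‖ ≤ Real.sqrt K * u⁻¹ := by
      refine le_of_sq_le_sq ?_ (by positivity)
      rw [mul_pow, Real.sq_sqrt hK0, inv_pow, ← div_eq_mul_inv]
      exact hsq
    rw [Real.rpow_neg (abs_nonneg _), ← hu]
    refine hfu.trans (mul_le_mul ?_ (by linarith) (by positivity) (by positivity))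
    linarith [mul_pos hM (Real.exp_pos 1)]
end

section
/- Let n ≥ 2 be an integer and let τ > 0, c > 0, M > 0, c̃ ≥ 1. There exists a constant C > 0, depending only on n, τ, c, M and c̃, with the following property. Let H be a real Hilbert space with orthonormal (Hilbert) basis (φ_k)_{k ≥ 1}, let (λ_k)_{k ≥ 1} be a sequence of positive reals with c̃^{-1} k^{2/n} ≤ λ_k ≤ c̃ k^{2/n} for all k, let f ∈ H with ‖f‖ ≤ M and Σ_{k ≥ 1} λ_k ⟨f, φ_k⟩² ≤ M², and let γ > 0. If for every integer k ≥ 1 and every ε ≥ 1 one has |⟨f, φ_k⟩| ≤ √λ_k/√ε + e^{τ λ_k²} e^{c ε} λ_k² γ, then ‖f‖ ≤ C (|ln γ|^{−1/(1+4n)} + γ). -/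
open RealInnerProductSpace

/-- Splitting Parseval's identity at a finite set of modes: uniform control of the coefficients
inside the set, spectral decay outside. -/
lemma HilbertBasis.norm_sq_le_card_mul_add_div {ι H : Type*} [NormedAddCommGroup H]
    [InnerProductSpace ℝ H] (φ : HilbertBasis ι ℝ H) {lam : ι → ℝ} {f : H}
    (F : Finset ι) {B Λ M : ℝ} (hΛ : 0 < Λ) (hlam : ∀ k, 0 < lam k)
    (hsum : Summable fun k => lam k * ⟪f, φ k⟫ ^ 2)
    (hM : ∑' k, lam k * ⟪f, φ k⟫ ^ 2 ≤ M ^ 2)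
    (hin : ∀ k ∈ F, |⟪f, φ k⟫| ≤ B) (hout : ∀ k ∉ F, Λ ≤ lam k) :
    ‖f‖ ^ 2 ≤ F.card * B ^ 2 + M ^ 2 / Λ := by
  classical
  have parseval : HasSum (fun k => ⟪f, φ k⟫ ^ 2) (‖f‖ ^ 2) := by
    have h := φ.hasSum_inner_mul_inner f f
    rw [real_inner_self_eq_norm_sq] at h
    refine h.congr_fun fun k => ?_
    rw [real_inner_comm f (φ k), sq]
  have hhead : HasSum (fun k => if k ∈ F then B ^ 2 else 0) (F.card * B ^ 2) := by
    have h : HasSum (fun k => if k ∈ F then B ^ 2 else 0)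
        (∑ k ∈ F, if k ∈ F then B ^ 2 else 0) :=
      hasSum_sum_of_ne_finset_zero fun k hk => if_neg hk
    simpa [Finset.sum_ite_mem] using h
  have hbound := hasSum_le (fun k => ?_) parseval (hhead.add (hsum.hasSum.div_const Λ))
  · exact hbound.trans (by gcongr)
  · by_cases hk : k ∈ F
    · have h1 : ⟪f, φ k⟫ ^ 2 ≤ B ^ 2 := sq_le_sq.2 ((hin k hk).trans (le_abs_self B))
      have h2 : 0 ≤ lam k * ⟪f, φ k⟫ ^ 2 / Λ := by have := hlam k; positivity
      simp only [if_pos hk]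
      linarith
    · simp only [if_neg hk, zero_add]
      rw [le_div_iff₀ hΛ, mul_comm]
      exact mul_le_mul_of_nonneg_right (hout k hk) (sq_nonneg _)

/-- The positive integers up to `x` form a finite set with at most `x` elements. -/
lemma exists_finset_pnat_le (x : ℝ) (hx : 0 ≤ x) :
    ∃ F : Finset ℕ+, (F.card : ℝ) ≤ x ∧ ∀ k : ℕ+, k ∈ F ↔ (k : ℝ) ≤ x := by
  refine ⟨(Finset.range ⌊x⌋₊).image Nat.succPNat, ?_, fun k => ?_⟩
  · refine le_trans (Nat.cast_le.2 Finset.card_image_le) ?_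
    simpa using Nat.floor_le hx
  · rw [← Nat.le_floor_iff hx]
    simp only [Finset.mem_image, Finset.mem_range]
    constructor
    · rintro ⟨m, hm, rfl⟩
      exact hm
    · intro h
      exact ⟨k.natPred, by have := k.natPred_add_one; omega, k.succPNat_natPred⟩

/-- The squared per-mode bound at `ε = u ^ (4n+1) / (2c)`, summed over `u ^ n` modes. -/
lemma pow_mul_sq_mode_bound_le {n : ℕ} (hn : 2 ≤ n) {τ c d u : ℝ} (hc : 0 < c)
    (hd : 1 ≤ d) (hu : 1 ≤ u) (hu' : 2 * τ * d ^ 2 + 1 ≤ u) :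
    u ^ n * (√(d * u ^ 2) / √(u ^ (4 * n + 1) / (2 * c)) +
      Real.exp (τ * (d * u ^ 2) ^ 2) * Real.exp (c * (u ^ (4 * n + 1) / (2 * c))) *
        (d * u ^ 2) ^ 2 * Real.exp (-u ^ (4 * n + 1))) ^ 2 ≤
    (4 * c * d + 2 * d ^ 4 * (n + 10).factorial) / u ^ 2 := by
  have hu0 : 0 < u := by linarith
  set P := √(d * u ^ 2) / √(u ^ (4 * n + 1) / (2 * c)) with hP
  set Q := Real.exp (τ * (d * u ^ 2) ^ 2) * Real.exp (c * (u ^ (4 * n + 1) / (2 * c))) *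
        (d * u ^ 2) ^ 2 * Real.exp (-u ^ (4 * n + 1)) with hQ
  have hP2 : u ^ n * P ^ 2 * u ^ 2 ≤ 2 * c * d := by
    have h : u ^ (n + 4) ≤ u ^ (4 * n + 1) := pow_le_pow_right₀ hu (by omega)
    rw [hP, div_pow, Real.sq_sqrt (by positivity), Real.sq_sqrt (by positivity)]
    have e : u ^ n * (d * u ^ 2 / (u ^ (4 * n + 1) / (2 * c))) * u ^ 2 =
        2 * c * d * (u ^ (n + 4) / u ^ (4 * n + 1)) := by
      rw [pow_add u n 4]
      field_simp
    rw [e]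
    exact mul_le_of_le_one_right (by positivity) ((div_le_one (by positivity)).2 h)
  have hQ2 : u ^ n * Q ^ 2 * u ^ 2 ≤ d ^ 4 * (n + 10).factorial := by
    have e : Q = d ^ 2 * u ^ 4 * Real.exp (τ * d ^ 2 * u ^ 4 - u ^ (4 * n + 1) / 2) := by
      have h : τ * d ^ 2 * u ^ 4 - u ^ (4 * n + 1) / 2 =
          τ * (d * u ^ 2) ^ 2 + c * (u ^ (4 * n + 1) / (2 * c)) + -u ^ (4 * n + 1) := by
        field_simp
        ring
      rw [hQ, h, Real.exp_add, Real.exp_add]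
      ring
    have e2 : u ^ n * Q ^ 2 * u ^ 2 =
        d ^ 4 * (u ^ (n + 10) * Real.exp (2 * τ * d ^ 2 * u ^ 4 - u ^ (4 * n + 1))) := by
      rw [e, mul_pow, ← Real.exp_nat_mul]
      push_cast
      ring_nf
    rw [e2]
    have hexp : 2 * τ * d ^ 2 * u ^ 4 - u ^ (4 * n + 1) ≤ -u := by
      have h5 : u ^ 5 ≤ u ^ (4 * n + 1) := pow_le_pow_right₀ hu (by omega)
      have h4 : u ≤ u ^ 4 := le_self_pow₀ hu (by norm_num)
      have h : (2 * τ * d ^ 2 + 1) * u ^ 4 ≤ u * u ^ 4 := by gcongr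
      nlinarith
    have hfac : u ^ (n + 10) * Real.exp (-u) ≤ (n + 10).factorial := by
      have h := Real.pow_div_factorial_le_exp u hu0.le (n + 10)
      rw [div_le_iff₀ (by positivity)] at h
      rw [Real.exp_neg, ← div_eq_mul_inv, div_le_iff₀ (Real.exp_pos u)]
      linarith
    gcongr
    exact le_trans (by gcongr) hfac
  rw [le_div_iff₀ (by positivity)]
  have h : u ^ n * (P + Q) ^ 2 * u ^ 2 ≤ u ^ n * (2 * (P ^ 2 + Q ^ 2)) * u ^ 2 := by
    gcongr
    exact add_sq_le
  linarith

/-- Abstract spectral skeleton of the stability theorem for the heat equation: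
per-mode bounds `|⟨f,φ_k⟩| ≤ √λ_k/√ε + e^{τ λ_k²} e^{cε} λ_k² γ` for `ε ≥ 1`, with the
Weyl bounds `c̃⁻¹ k^{2/n} ≤ λ_k ≤ c̃ k^{2/n}` and the a priori bounds `‖f‖ ≤ M`,
`Σ λ_k ⟨f,φ_k⟩² ≤ M²`, imply `‖f‖ ≤ C (|ln γ|^{-1/(1+4n)} + γ)`. -/
theorem heat_stability_skeleton (n : ℕ) (hn : 2 ≤ n) (τ c M ctilde : ℝ)
    (hτ : 0 < τ) (hc : 0 < c) (hM : 0 < M) (hctilde : 1 ≤ ctilde) :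
    ∃ C > 0, ∀ (H : Type) (_ : NormedAddCommGroup H), ∀ (_ : InnerProductSpace ℝ H)
      (_ : CompleteSpace H) (φ : HilbertBasis ℕ+ ℝ H) (lam : ℕ+ → ℝ) (f : H) (γ : ℝ),
      (∀ k, 0 < lam k) →
      (∀ k : ℕ+, ctilde⁻¹ * (k : ℝ) ^ ((2 : ℝ) / n) ≤ lam k ∧
        lam k ≤ ctilde * (k : ℝ) ^ ((2 : ℝ) / n)) →
      ‖f‖ ≤ M →
      Summable (fun k => lam k * ⟪f, φ k⟫ ^ 2) →
      (∑' k, lam k * ⟪f, φ k⟫ ^ 2) ≤ M ^ 2 →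
      0 < γ →
      (∀ k : ℕ+, ∀ ε : ℝ, 1 ≤ ε →
        |⟪f, φ k⟫| ≤ Real.sqrt (lam k) / Real.sqrt ε +
          Real.exp (τ * lam k ^ 2) * Real.exp (c * ε) * lam k ^ 2 * γ) →
      ‖f‖ ≤ C * (|Real.log γ| ^ (-(1 / (1 + 4 * (n : ℝ)))) + γ) := by
  have hd0 : 0 < ctilde := by linarith
  set u₀ : ℝ := 2 * τ * ctilde ^ 2 + 1 + 2 * c with hu₀
  have hu₀1 : 1 ≤ u₀ := by
    have : 0 < τ * ctilde ^ 2 := by positivity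
    linarith
  set D : ℝ := 4 * c * ctilde + 2 * ctilde ^ 4 * (n + 10).factorial + M ^ 2 * ctilde with hD
  have hD0 : 0 < D := by positivity
  refine ⟨√D + M * Real.exp (u₀ ^ (4 * n + 1)), by positivity, ?_⟩
  intro H _ _ _ φ lam f γ hlam hweyl hf hsum hsumM hγ hmode
  set a : ℝ := 1 / (1 + 4 * (n : ℝ)) with ha
  rcases le_total (Real.exp (-u₀ ^ (4 * n + 1))) γ with hlarge | hsmall
  · calc ‖f‖ ≤ M := hf
      _ = M * Real.exp (u₀ ^ (4 * n + 1)) * Real.exp (-u₀ ^ (4 * n + 1)) := by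
        rw [mul_assoc, ← Real.exp_add]
        simp
      _ ≤ (√D + M * Real.exp (u₀ ^ (4 * n + 1))) * (|Real.log γ| ^ (-a) + γ) := by
        gcongr
        · exact le_add_of_nonneg_left (Real.sqrt_nonneg D)
        · exact hlarge.trans (le_add_of_nonneg_left (by positivity))
  · have hlog : Real.log γ ≤ -u₀ ^ (4 * n + 1) := (Real.log_le_iff_le_exp hγ).2 hsmall
    have hpow1 : 1 ≤ u₀ ^ (4 * n + 1) := one_le_pow₀ hu₀1
    have habs : |Real.log γ| = -Real.log γ := abs_of_nonpos (by linarith)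
    set L : ℝ := |Real.log γ| with hL
    have hLu₀ : u₀ ^ (4 * n + 1) ≤ L := by linarith
    have hL0 : 0 < L := by linarith
    set u : ℝ := L ^ a with hu
    have ha' : a = ((4 * n + 1 : ℕ) : ℝ)⁻¹ := by
      rw [ha]
      push_cast
      rw [one_div, add_comm]
    have huL : u ^ (4 * n + 1) = L := by
      rw [hu, ha']
      exact Real.rpow_inv_natCast_pow hL0.le (by omega)
    have hu0 : 0 < u := by positivity
    have hu₀u : u₀ ≤ u := le_of_pow_le_pow_left₀ (by omega) hu0.le (huL ▸ hLu₀)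
    have hu1 : 1 ≤ u := hu₀1.trans hu₀u
    have hγL : γ = Real.exp (-u ^ (4 * n + 1)) := by
      rw [huL, habs, neg_neg, Real.exp_log hγ]
    have hε : 1 ≤ u ^ (4 * n + 1) / (2 * c) := by
      rw [one_le_div (by positivity)]
      have h : u ≤ u ^ (4 * n + 1) := le_self_pow₀ hu1 (by omega)
      have : 0 < τ * ctilde ^ 2 := by positivity
      linarith
    have hroot : (u ^ n) ^ ((2 : ℝ) / n) = u ^ 2 := by
      rw [← Real.rpow_natCast u n, ← Real.rpow_mul hu0.le,
        mul_div_cancel₀ _ (by positivity : (n : ℝ) ≠ 0)]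
      exact Real.rpow_natCast u 2
    obtain ⟨F, hFcard, hF⟩ := exists_finset_pnat_le (u ^ n) (by positivity)
    have hsplit := φ.norm_sq_le_card_mul_add_div F (Λ := ctilde⁻¹ * u ^ 2) (by positivity)
      hlam hsum hsumM
      (B := √(ctilde * u ^ 2) / √(u ^ (4 * n + 1) / (2 * c)) +
        Real.exp (τ * (ctilde * u ^ 2) ^ 2) * Real.exp (c * (u ^ (4 * n + 1) / (2 * c))) *
          (ctilde * u ^ 2) ^ 2 * Real.exp (-u ^ (4 * n + 1)))
      (fun k hk => by
        have hk' : lam k ≤ ctilde * u ^ 2 := by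
          refine (hweyl k).2.trans ?_
          rw [← hroot]
          have := (hF k).1 hk
          gcongr
        have := hlam k
        refine (hmode k _ hε).trans ?_
        rw [hγL]
        gcongr)
      (fun k hk => by
        refine le_trans ?_ (hweyl k).1
        rw [← hroot]
        have := not_le.1 (fun h => hk ((hF k).2 h))
        gcongr)
    have hhead := pow_mul_sq_mode_bound_le hn (τ := τ) hc hctilde hu1 (by linarith)
    have hsq : ‖f‖ ^ 2 ≤ D / u ^ 2 := by
      have htail : M ^ 2 / (ctilde⁻¹ * u ^ 2) = M ^ 2 * ctilde / u ^ 2 := by field_simp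
      rw [htail] at hsplit
      rw [hD, add_div]
      refine hsplit.trans (add_le_add_left (le_trans ?_ hhead) _)
      gcongr
    calc ‖f‖ ≤ √(D / u ^ 2) := Real.le_sqrt_of_sq_le hsq
      _ = √D * L ^ (-a) := by
        rw [Real.sqrt_div hD0.le, Real.sqrt_sq hu0.le, Real.rpow_neg hL0.le, div_eq_mul_inv]
      _ ≤ (√D + M * Real.exp (u₀ ^ (4 * n + 1))) * (L ^ (-a) + γ) := by
        gcongr
        · exact le_add_of_nonneg_right (by positivity)
        · exact le_add_of_nonneg_right hγ.le
end
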